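/- For |δ| < 1 and a, b ∈ ℝ, let Z_δ be a bivariate centered Gaussian random vector with covariance matrix [[1, δ],[δ, 1]], let R_{a,b} = [a,∞) × [b,∞), and let ψ(t,x,y) = (1/(2π√(1−t²))) exp( −(x² − 2txy + y²)/(2(1−t²)) ) be the density of Z_t. Then P(Z_δ ∈ R_{a,b}) − P(Z_0 ∈ R_{a,b}) = ∫_0^δ ψ(t,a,b) dt. -/

import Mathlib

open MeasureTheory

noncomputable section

/-- The density `ψ(t,x,y)` of the bivariate centered Gaussian vector `Z_t` with
covariance matrix `[[1, t], [t, 1]]`, for `|t| < 1`. -/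
def psi (t x y : ℝ) : ℝ :=
  (1 / (2 * Real.pi * Real.sqrt (1 - t ^ 2))) *
    Real.exp (-(x ^ 2 - 2 * t * x * y + y ^ 2) / (2 * (1 - t ^ 2)))

/-- `P(Z_δ ∈ R_{a,b})`, the probability that `Z_δ` lies in the quadrant
`R_{a,b} = [a,∞) × [b,∞)`, expressed via the density `ψ`. -/
def quadProb (δ a b : ℝ) : ℝ :=
  ∫ z : ℝ × ℝ in Set.Ici a ×ˢ Set.Ici b, psi δ z.1 z.2

/-- `psi` factors through the standard Gaussian after completing the square in `y`. -/
lemma psi_eq_mul (t x y : ℝ) (ht : |t| < 1) :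
    psi t x y = (1 / (2 * Real.pi * √(1 - t ^ 2))) *
      (Real.exp (-x ^ 2 / 2) * Real.exp (-((y - t * x) / √(1 - t ^ 2)) ^ 2 / 2)) := by
  have h : 0 < 1 - t ^ 2 := by linarith [(sq_lt_one_iff_abs_lt_one t).2 ht]
  rw [psi, ← Real.exp_add, div_pow, Real.sq_sqrt h.le]
  congr 2
  field_simp
  ring

lemma psi_comm (t x y : ℝ) : psi t x y = psi t y x := by
  unfold psi
  congr 3
  ring

lemma psi_nonneg (t x y : ℝ) : 0 ≤ psi t x y := by
  unfold psi
  positivity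

lemma psi_le_exp_fst {t r : ℝ} (htr : |t| ≤ r) (hr : r < 1) (x y : ℝ) :
    psi t x y ≤ 1 / (2 * Real.pi * √(1 - r ^ 2)) * Real.exp (-x ^ 2 / 2) := by
  have h : 0 < 1 - r ^ 2 := by nlinarith [abs_nonneg t]
  have h' : 1 - r ^ 2 ≤ 1 - t ^ 2 := by nlinarith [abs_nonneg t, sq_abs t]
  rw [psi_eq_mul t x y (htr.trans_lt hr)]
  have hs := Real.sqrt_pos.2 h
  gcongr
  refine mul_le_of_le_one_right (Real.exp_pos _).le (Real.exp_le_one_iff.2 ?_)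
  nlinarith [sq_nonneg ((y - t * x) / √(1 - t ^ 2))]

lemma psi_le_exp_mul_exp {t : ℝ} (ht : |t| < 1) (x y : ℝ) :
    psi t x y ≤ 1 / (2 * Real.pi * √(1 - |t| ^ 2)) *
      (Real.exp (-(1 / 4) * x ^ 2) * Real.exp (-(1 / 4) * y ^ 2)) := by
  rw [← Real.exp_add]
  rcases le_total (x ^ 2) (y ^ 2) with h | h
  · rw [psi_comm]
    refine (psi_le_exp_fst le_rfl ht y x).trans ?_
    gcongr
    linarith
  · refine (psi_le_exp_fst le_rfl ht x y).trans ?_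
    gcongr
    linarith

lemma continuous_psi (t : ℝ) : Continuous fun z : ℝ × ℝ => psi t z.1 z.2 := by
  unfold psi
  fun_prop

lemma integrable_psi {t : ℝ} (ht : |t| < 1) : Integrable fun z : ℝ × ℝ => psi t z.1 z.2 := by
  have hg : Integrable fun x : ℝ => Real.exp (-(1 / 4) * x ^ 2) :=
    integrable_exp_neg_mul_sq (by norm_num)
  refine ((hg.mul_prod hg).const_mul (1 / (2 * Real.pi * √(1 - |t| ^ 2)))).mono'
    (continuous_psi t).aestronglyMeasurable (.of_forall fun z => ?_)
  rw [Real.norm_of_nonneg (psi_nonneg ..)]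
  exact psi_le_exp_mul_exp ht _ _

lemma integrable_exp_neg_sq_div_two : Integrable fun x : ℝ => Real.exp (-x ^ 2 / 2) := by
  convert integrable_exp_neg_mul_sq (b := 1 / 2) (by norm_num) using 3
  ring

/-- The (unnormalized) upper tail of the standard Gaussian. -/
def gaussTail (u : ℝ) : ℝ := ∫ v in Set.Ioi u, Real.exp (-v ^ 2 / 2)

lemma hasDerivAt_gaussTail (u : ℝ) : HasDerivAt gaussTail (-Real.exp (-u ^ 2 / 2)) u := by
  have hc : Continuous fun v : ℝ => Real.exp (-v ^ 2 / 2) := by fun_prop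
  have hE : gaussTail = fun w => gaussTail 0 - ∫ v in (0 : ℝ)..w, Real.exp (-v ^ 2 / 2) := by
    funext w
    rw [← intervalIntegral.integral_Ioi_sub_Ioi' integrable_exp_neg_sq_div_two.integrableOn
      integrable_exp_neg_sq_div_two.integrableOn]
    simp [gaussTail]
  rw [hE]
  exact (hc.integral_hasStrictDerivAt 0 u).hasDerivAt.const_sub _

lemma continuous_gaussTail : Continuous gaussTail :=
  continuous_iff_continuousAt.2 fun u => (hasDerivAt_gaussTail u).continuousAt

lemma abs_gaussTail_le (u : ℝ) : |gaussTail u| ≤ ∫ v : ℝ, Real.exp (-v ^ 2 / 2) := by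
  rw [gaussTail, abs_of_nonneg (integral_nonneg fun _ => (Real.exp_pos _).le)]
  exact setIntegral_le_integral integrable_exp_neg_sq_div_two
    (.of_forall fun _ => (Real.exp_pos _).le)

/-- The unnormalized Gaussian tail of an affine image. -/
lemma integral_Ioi_exp_affine (b c : ℝ) {s : ℝ} (hs : 0 < s) :
    ∫ y in Set.Ioi b, Real.exp (-((y - c) / s) ^ 2 / 2) = s * gaussTail ((b - c) / s) := by
  have h1 := (measurePreserving_sub_right volume c).setIntegral_preimage_emb
    (measurableEmbedding_subRight c) (fun y => Real.exp (-(y / s) ^ 2 / 2)) (Set.Ioi (b - c))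
  have h2 := integral_comp_mul_left_Ioi (fun y => Real.exp (-y ^ 2 / 2)) (b - c) (inv_pos.2 hs)
  simp only [Set.preimage_sub_const_Ioi, sub_add_cancel] at h1
  rw [h1, gaussTail]
  simpa [div_eq_inv_mul] using h2

lemma integral_psi_Ioi {t : ℝ} (ht : |t| < 1) (x b : ℝ) :
    ∫ y in Set.Ioi b, psi t x y = 1 / (2 * Real.pi) *
      (Real.exp (-x ^ 2 / 2) * gaussTail ((b - t * x) / √(1 - t ^ 2))) := by
  have h : 0 < √(1 - t ^ 2) :=
    Real.sqrt_pos.2 (by linarith [(sq_lt_one_iff_abs_lt_one t).2 ht])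
  simp_rw [psi_eq_mul t x _ ht, integral_const_mul, integral_Ioi_exp_affine b (t * x) h]
  field_simp

lemma quadProb_eq_integral_gaussTail {t : ℝ} (ht : |t| < 1) (a b : ℝ) :
    quadProb t a b = ∫ x in Set.Ioi a, 1 / (2 * Real.pi) *
      (Real.exp (-x ^ 2 / 2) * gaussTail ((b - t * x) / √(1 - t ^ 2))) := by
  rw [quadProb, Measure.volume_eq_prod, setIntegral_prod _ (integrable_psi ht).integrableOn,
    integral_Ici_eq_integral_Ioi]
  simp_rw [integral_Ici_eq_integral_Ioi, integral_psi_Ioi ht]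

lemma hasDerivAt_psi_fst {t : ℝ} (x b : ℝ) :
    HasDerivAt (fun x => psi t x b) (-((x - t * b) / (1 - t ^ 2) * psi t x b)) x := by
  have h1 : HasDerivAt (fun x : ℝ => -(x ^ 2 - 2 * t * x * b + b ^ 2) / (2 * (1 - t ^ 2)))
      (-(2 * x - 2 * t * b) / (2 * (1 - t ^ 2))) x := by
    have := ((((hasDerivAt_id x).pow 2).sub
      (((hasDerivAt_id x).const_mul (2 * t)).mul_const b)).add_const (b ^ 2)).neg.div_const
        (2 * (1 - t ^ 2))
    simpa using this
  refine (h1.exp.const_mul (1 / (2 * Real.pi * √(1 - t ^ 2)))).congr_deriv ?_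
  rw [psi, show -(2 * x - 2 * t * b) / (2 * (1 - t ^ 2)) = -((x - t * b) / (1 - t ^ 2)) by
    rw [show -(2 * x - 2 * t * b) = 2 * -(x - t * b) by ring,
      mul_div_mul_left _ _ two_ne_zero, neg_div]]
  ring

/-- The derivative in the correlation parameter of the marginal tail. -/
lemma hasDerivAt_gaussTail_correlation {t : ℝ} (ht : |t| < 1) (x b : ℝ) :
    HasDerivAt (fun t => 1 / (2 * Real.pi) *
      (Real.exp (-x ^ 2 / 2) * gaussTail ((b - t * x) / √(1 - t ^ 2))))
      ((x - t * b) / (1 - t ^ 2) * psi t x b) t := by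
  have h : 0 < 1 - t ^ 2 := by linarith [(sq_lt_one_iff_abs_lt_one t).2 ht]
  have hs := Real.sqrt_pos.2 h
  have hsq := Real.sq_sqrt h.le
  have h1 : HasDerivAt (fun t : ℝ => √(1 - t ^ 2)) (-(2 * t) / (2 * √(1 - t ^ 2))) t := by
    have := (((hasDerivAt_id t).pow 2).const_sub 1).sqrt (by simpa using h.ne')
    simpa using this
  have h2 : HasDerivAt (fun t : ℝ => b - t * x) (-x) t := by
    simpa using ((hasDerivAt_id t).mul_const x).const_sub b
  have h3 := (((hasDerivAt_gaussTail _).comp t (h2.div h1 hs.ne')).const_mul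
    (Real.exp (-x ^ 2 / 2))).const_mul (1 / (2 * Real.pi))
  refine h3.congr_deriv ?_
  rw [psi_eq_mul t x b ht]
  have h4 : (-x * √(1 - t ^ 2) - (b - t * x) * (-(2 * t) / (2 * √(1 - t ^ 2)))) / √(1 - t ^ 2) ^ 2
      = -((x - t * b) / ((1 - t ^ 2) * √(1 - t ^ 2))) := by
    rw [hsq]
    field_simp
    rw [hsq]
    ring
  rw [h4]
  simp only [Pi.div_apply]
  field_simp

/-- An integrable majorant, uniform in `|t| ≤ r`, of the derivative in the correlation. -/
lemma norm_deriv_psi_le {t r : ℝ} (htr : |t| ≤ r) (hr : r < 1) (x b : ℝ) :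
    ‖(x - t * b) / (1 - t ^ 2) * psi t x b‖ ≤ (|x| + |b|) / (1 - r ^ 2) *
      (1 / (2 * Real.pi * √(1 - r ^ 2)) * Real.exp (-x ^ 2 / 2)) := by
  have h : 0 < 1 - r ^ 2 := by nlinarith [abs_nonneg t]
  have h' : 1 - r ^ 2 ≤ 1 - t ^ 2 := by nlinarith [abs_nonneg t, sq_abs t]
  rw [norm_mul, norm_div, Real.norm_of_nonneg (psi_nonneg ..), Real.norm_of_nonneg (h.le.trans h'),
    Real.norm_eq_abs]
  have hx : |x - t * b| ≤ |x| + |b| := by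
    refine (abs_sub _ _).trans ?_
    rw [abs_mul]
    nlinarith [abs_nonneg b]
  have := psi_le_exp_fst htr hr x b
  have := psi_nonneg t x b
  gcongr

lemma integrable_deriv_psi_majorant (r b : ℝ) :
    Integrable fun x : ℝ => (|x| + |b|) / (1 - r ^ 2) *
      (1 / (2 * Real.pi * √(1 - r ^ 2)) * Real.exp (-x ^ 2 / 2)) := by
  have h1 : Integrable fun x : ℝ => |x| * Real.exp (-x ^ 2 / 2) := by
    have := (integrable_mul_exp_neg_mul_sq (b := 1 / 2) (by norm_num)).norm
    convert this using 2 with x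
    rw [norm_mul, Real.norm_eq_abs, Real.norm_of_nonneg (Real.exp_pos _).le]
    congr 2
    ring
  convert (h1.add (integrable_exp_neg_sq_div_two.const_mul |b|)).const_mul
    (1 / (1 - r ^ 2) * (1 / (2 * Real.pi * √(1 - r ^ 2)))) using 2 with x
  simp only [Pi.add_apply]
  ring

lemma integral_deriv_psi {t : ℝ} (ht : |t| < 1) (a b : ℝ) :
    ∫ x in Set.Ioi a, (x - t * b) / (1 - t ^ 2) * psi t x b = psi t a b := by
  have hc : Continuous fun x => psi t x b := (continuous_psi t).comp (Continuous.prodMk_left b)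
  have hi' : IntegrableOn (fun x => -((x - t * b) / (1 - t ^ 2) * psi t x b)) (Set.Ioi a) := by
    refine ((integrable_deriv_psi_majorant |t| b).mono' ?_
      (.of_forall fun x => norm_deriv_psi_le le_rfl ht x b)).neg.integrableOn
    exact Continuous.aestronglyMeasurable (by fun_prop)
  have hi : IntegrableOn (fun x => psi t x b) (Set.Ioi a) := by
    refine ((integrable_exp_neg_sq_div_two.const_mul (1 / (2 * Real.pi * √(1 - |t| ^ 2)))).mono'
      hc.aestronglyMeasurable (.of_forall fun x => ?_)).integrableOn
    rw [Real.norm_of_nonneg (psi_nonneg ..)]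
    exact psi_le_exp_fst le_rfl ht x b
  have h := integral_Ioi_of_hasDerivAt_of_tendsto' (fun x _ => hasDerivAt_psi_fst x b) hi'
    (tendsto_zero_of_hasDerivAt_of_integrableOn_Ioi (fun x _ => hasDerivAt_psi_fst x b) hi' hi)
  rw [integral_neg] at h
  linarith

/-- Plackett's identity: the quadrant probability has derivative `psi t a b` in `t`. -/
lemma hasDerivAt_quadProb {t : ℝ} (ht : |t| < 1) (a b : ℝ) :
    HasDerivAt (fun t => quadProb t a b) (psi t a b) t := by
  obtain ⟨r, htr, hr⟩ := exists_between ht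
  have hnhds : {u : ℝ | |u| < r} ∈ nhds t :=
    (isOpen_lt continuous_abs continuous_const).mem_nhds htr
  have hmeas : ∀ u : ℝ, Continuous fun x : ℝ => 1 / (2 * Real.pi) *
      (Real.exp (-x ^ 2 / 2) * gaussTail ((b - u * x) / √(1 - u ^ 2))) := fun u => by
    have := continuous_gaussTail
    fun_prop
  have hc : Continuous fun x => psi t x b := (continuous_psi t).comp (Continuous.prodMk_left b)
  have hint : IntegrableOn (fun x : ℝ => 1 / (2 * Real.pi) *
      (Real.exp (-x ^ 2 / 2) * gaussTail ((b - t * x) / √(1 - t ^ 2)))) (Set.Ioi a) := by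
    have := integrable_exp_neg_sq_div_two.mul_bdd
      (c := ∫ v : ℝ, Real.exp (-v ^ 2 / 2))
      (Continuous.aestronglyMeasurable (continuous_gaussTail.comp
        (by fun_prop : Continuous fun x : ℝ => (b - t * x) / √(1 - t ^ 2))))
      (.of_forall fun x => abs_gaussTail_le _)
    exact (this.const_mul _).integrableOn
  have h := (hasDerivAt_integral_of_dominated_loc_of_deriv_le
    (μ := volume.restrict (Set.Ioi a)) hnhds
    (.of_forall fun u => (hmeas u).aestronglyMeasurable) hint
    (F' := fun u x => (x - u * b) / (1 - u ^ 2) * psi u x b)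
    (Continuous.aestronglyMeasurable (by fun_prop))
    (.of_forall fun x u hu => norm_deriv_psi_le (le_of_lt hu) hr x b)
    (integrable_deriv_psi_majorant r b).integrableOn
    (.of_forall fun x u hu => hasDerivAt_gaussTail_correlation (lt_trans hu hr) x b)).2
  rw [integral_deriv_psi ht] at h
  refine h.congr_of_eventuallyEq ?_
  filter_upwards [hnhds] with u hu
  exact quadProb_eq_integral_gaussTail (lt_trans hu hr) a b

/-- Proposition 3: for `|δ| < 1` and `a, b ∈ ℝ`,
`P(Z_δ ∈ R_{a,b}) - P(Z_0 ∈ R_{a,b}) = ∫_0^δ ψ(t,a,b) dt`. -/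
theorem quadProb_sub_eq_integral (δ a b : ℝ) (hδ : |δ| < 1) :
    quadProb δ a b - quadProb 0 a b = ∫ t in (0 : ℝ)..δ, psi t a b := by
  have habs : ∀ t ∈ Set.uIcc 0 δ, |t| < 1 := fun t ht => by
    have := Set.abs_sub_left_of_mem_uIcc ht
    simp only [sub_zero] at this
    exact this.trans_lt hδ
  refine (intervalIntegral.integral_eq_sub_of_hasDerivAt
    (fun t ht => hasDerivAt_quadProb (habs t ht) a b) ?_).symm
  refine ContinuousOn.intervalIntegrable fun t ht => ContinuousAt.continuousWithinAt ?_
  have h : 0 < 1 - t ^ 2 := by linarith [(sq_lt_one_iff_abs_lt_one t).2 (habs t ht)]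
  have hs := Real.sqrt_pos.2 h
  unfold psi
  have hd : 2 * Real.pi * √(1 - t ^ 2) ≠ 0 := by positivity
  have hd' : 2 * (1 - t ^ 2) ≠ 0 := by positivity
  fun_prop (disch := assumption)
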